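/- Suppose K_n → ∞, K_n²/P_n → 0, and the sequence (n·p_{e,q}(n) − ln n)/ln ln n is bounded. Fix constant integers m ≥ 1 and h ≥ 0. Then the probability of the event that the vertices v_1, …, v_m all have degree exactly h in 𝔾_q(n,K_n,P_n,p_n) AND (either some two vertices among v_1, …, v_m are adjacent to each other, or some vertex outside {v_1,…,v_m} is adjacent to at least two of v_1,…,v_m) is o((h!)^{−m}·(n·p_{e,q}(n))^{hm}·e^{−m·n·p_{e,q}(n)}) as n → ∞. -/

import Mathlib

open Finset Filter

/-- A configuration of the random graph `𝔾_q(n,K,P,p)`: a key-ring assignment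
(one finite subset of the key pool `Fin P` per vertex) together with the
on/off states of the channels (one Boolean per unordered pair of vertices). -/
abbrev Config (n P : ℕ) : Type := (Fin n → Finset (Fin P)) × (Sym2 (Fin n) → Bool)

/-- Probability weight of a configuration: the key rings are independent and
uniform over the `K`-element subsets of the pool of size `P`, and the channels
are independent Bernoulli(`p`). -/
noncomputable def weight (n K P : ℕ) (p : ℝ) (ω : Config n P) : ℝ :=
  (∏ i : Fin n, if (ω.1 i).card = K then ((P.choose K : ℝ))⁻¹ else 0) *
  (∏ e : Sym2 (Fin n), if ω.2 e then p else 1 - p)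

/-- Probability of an event in `𝔾_q(n,K,P,p)`. -/
noncomputable def prob (n K P : ℕ) (p : ℝ) (E : Set (Config n P)) : ℝ :=
  ∑ ω : Config n P, Set.indicator E (weight n K P p) ω

/-- Adjacency in `𝔾_q(n,K,P,p)`: two distinct vertices are adjacent iff their
key rings share at least `q` keys and the channel between them is on. -/
def Adj (q n P : ℕ) (ω : Config n P) (i j : Fin n) : Prop :=
  i ≠ j ∧ q ≤ ((ω.1 i) ∩ (ω.1 j)).card ∧ ω.2 s(i, j) = true

/-- Degree of a vertex. -/
noncomputable def degree (q n P : ℕ) (ω : Config n P) (i : Fin n) : ℕ :=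
  Nat.card {j : Fin n // Adj q n P ω i j}

/-- Minimum degree of the graph. -/
noncomputable def minDeg (q n P : ℕ) (ω : Config n P) : ℕ :=
  sInf (Set.range fun i => degree q n P ω i)

/-- `p_{s,q}`: the probability that two key rings share at least `q` keys. -/
noncomputable def psq (q K P : ℕ) : ℝ :=
  1 - ∑ u ∈ Finset.range q,
    ((K.choose u : ℝ) * ((P - K).choose (K - u) : ℝ)) / (P.choose K : ℝ)

/-- `p_{e,q}`: the probability that two distinct vertices are adjacent. -/
noncomputable def peq (q K P : ℕ) (p : ℝ) : ℝ := p * psq q K P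

section ProductExpectation

variable {ι α : Type*} [Fintype ι] [DecidableEq ι] [Fintype α]

/-- Resampling one coordinate of a product measure. -/
lemma sum_prod_mul_resample_single (μ : α → ℝ) (hμ : ∑ s, μ s = 1) (w : ι)
    (g : (ι → α) → α → ℝ) (hg : ∀ S a s, g (Function.update S w a) s = g S s) :
    ∑ S : ι → α, (∏ i, μ (S i)) * g S (S w) =
      ∑ S : ι → α, (∏ i, μ (S i)) * ∑ s, μ s * g S s := by
  have hswap : ∀ (S : ι → α) (a : α),
      (∏ i, μ (Function.update S w a i)) * μ (S w) = (∏ i, μ (S i)) * μ a := by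
    intro S a
    rw [← Finset.mul_prod_erase univ (fun i => μ (Function.update S w a i)) (mem_univ w),
      ← Finset.mul_prod_erase univ (fun i => μ (S i)) (mem_univ w)]
    have : ∏ i ∈ univ.erase w, μ (Function.update S w a i) = ∏ i ∈ univ.erase w, μ (S i) :=
      Finset.prod_congr rfl fun i hi => by
        rw [Function.update_of_ne (Finset.ne_of_mem_erase hi)]
    rw [this, Function.update_self]
    ring
  have hinv : ∀ x : (ι → α) × α,
      (Function.update (Function.update x.1 w x.2) w (x.1 w),
        Function.update x.1 w x.2 w) = x := by
    intro x
    simp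
  symm
  calc ∑ S : ι → α, (∏ i, μ (S i)) * ∑ s, μ s * g S s
      = ∑ x : (ι → α) × α, (∏ i, μ (x.1 i)) * μ x.2 * g x.1 x.2 := by
        rw [Fintype.sum_prod_type]
        exact Finset.sum_congr rfl fun S _ => by
          rw [Finset.mul_sum]; exact Finset.sum_congr rfl fun s _ => by ring
    _ = ∑ x : (ι → α) × α, (∏ i, μ (x.1 i)) * μ x.2 * g x.1 (x.1 w) := by
        refine Finset.sum_nbij' (fun x => (Function.update x.1 w x.2, x.1 w))
          (fun x => (Function.update x.1 w x.2, x.1 w)) (by simp) (by simp)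
          (fun x _ => hinv x) (fun x _ => hinv x) fun x _ => ?_
        simp only [hg, hswap, Function.update_self]
    _ = ∑ S : ι → α, (∏ i, μ (S i)) * g S (S w) := by
        rw [Fintype.sum_prod_type]
        refine Finset.sum_congr rfl fun S _ => ?_
        dsimp only
        rw [← Finset.sum_mul, ← Finset.mul_sum, hμ, mul_one]

/-- Integrating out the coordinates in `B`, conditionally on those outside `B`. -/
lemma sum_prod_mul_resample (μ : α → ℝ) (hμ : ∑ s, μ s = 1) (B : Finset ι)
    (g : ι → (ι → α) → α → ℝ)
    (hg : ∀ w ∈ B, ∀ v ∈ B, ∀ S a s, g w (Function.update S v a) s = g w S s) :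
    ∑ S : ι → α, (∏ i, μ (S i)) * ∏ w ∈ B, g w S (S w) =
      ∑ S : ι → α, (∏ i, μ (S i)) * ∏ w ∈ B, ∑ s, μ s * g w S s := by
  suffices H : ∀ C : Finset ι, C ⊆ B → ∀ F : (ι → α) → ℝ,
      (∀ v ∈ C, ∀ S a, F (Function.update S v a) = F S) →
      ∑ S : ι → α, (∏ i, μ (S i)) * (F S * ∏ w ∈ C, g w S (S w)) =
      ∑ S : ι → α, (∏ i, μ (S i)) * (F S * ∏ w ∈ C, ∑ s, μ s * g w S s) by
    simpa using H B subset_rfl (fun _ => 1) (by simp)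
  intro C
  induction C using Finset.induction_on with
  | empty => simp
  | insert w C hw ih =>
    intro hC F hF
    have hwB : w ∈ B := hC (mem_insert_self _ _)
    have hCB : C ⊆ B := fun x hx => hC (mem_insert_of_mem hx)
    simp only [Finset.prod_insert hw]
    have h1 := sum_prod_mul_resample_single μ hμ w
      (fun S s => F S * ((∏ v ∈ C, g v S (S v)) * g w S s)) (by
        intro S a s
        have : ∏ v ∈ C, g v (Function.update S w a) (Function.update S w a v) =
            ∏ v ∈ C, g v S (S v) := Finset.prod_congr rfl fun v hv => by
          rw [hg v (hCB hv) w hwB, Function.update_of_ne (by rintro rfl; exact hw hv)]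
        simp only [this, hF w (mem_insert_self _ _), hg w hwB w hwB])
    have h2 := ih hCB (fun S => F S * ∑ s, μ s * g w S s) (by
      intro v hv S a
      simp only [hF v (mem_insert_of_mem hv), hg w hwB v (hCB hv)])
    calc _ = ∑ S : ι → α, (∏ i, μ (S i)) * (F S * ((∏ v ∈ C, g v S (S v)) * g w S (S w))) :=
          Finset.sum_congr rfl fun S _ => by ring
      _ = _ := h1
      _ = ∑ S : ι → α, (∏ i, μ (S i)) *
            ((F S * ∑ s, μ s * g w S s) * ∏ v ∈ C, g v S (S v)) :=
          Finset.sum_congr rfl fun S _ => by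
            simp only [Finset.mul_sum, Finset.sum_mul]
            exact Finset.sum_congr rfl fun s _ => by ring
      _ = _ := h2
      _ = _ := Finset.sum_congr rfl fun S _ => by ring

lemma sum_prod_eq_one (μ : α → ℝ) (hμ : ∑ s, μ s = 1) :
    ∑ S : ι → α, ∏ i, μ (S i) = 1 := by
  simpa [hμ] using (Finset.prod_univ_sum (fun _ : ι => (univ : Finset α)) (fun _ s => μ s)).symm

/-- Expectation of a product of functions of distinct independent coordinates. -/
lemma sum_prod_mul_prod_comp {κ : Type*} [DecidableEq κ] (μ : α → ℝ) (hμ : ∑ s, μ s = 1)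
    (D : Finset κ) (φ : κ → ι) (hφ : Set.InjOn φ D) (F : κ → α → ℝ) :
    ∑ S : ι → α, (∏ i, μ (S i)) * ∏ x ∈ D, F x (S (φ x)) =
      ∏ x ∈ D, ∑ s, μ s * F x s := by
  classical
  induction D using Finset.induction_on with
  | empty => simpa using sum_prod_eq_one μ hμ
  | insert x D hx ih =>
    have hxD : ∀ y ∈ D, φ y ≠ φ x := fun y hy h => hx <|
      hφ (mem_insert_of_mem hy) (mem_insert_self x D) h ▸ hy
    have h1 := sum_prod_mul_resample_single μ hμ (φ x)
      (fun S s => (∏ y ∈ D, F y (S (φ y))) * F x s) (by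
        intro S a s
        congr 1
        exact Finset.prod_congr rfl fun y hy => by rw [Function.update_of_ne (hxD y hy)])
    simp only [Finset.prod_insert hx]
    rw [← ih (hφ.mono (by simp)), Finset.mul_sum]
    calc _ = ∑ S : ι → α, (∏ i, μ (S i)) * ((∏ y ∈ D, F y (S (φ y))) * F x (S (φ x))) :=
          Finset.sum_congr rfl fun S _ => by ring
      _ = _ := h1
      _ = _ := Finset.sum_congr rfl fun S _ => by
        simp only [Finset.mul_sum, Finset.sum_mul]
        exact Finset.sum_congr rfl fun s _ => by ring

end ProductExpectation

section KeyRings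

/-- The uniform distribution on `K`-element key rings. -/
noncomputable def ringMass (K P : ℕ) (s : Finset (Fin P)) : ℝ :=
  if s.card = K then ((P.choose K : ℝ))⁻¹ else 0

lemma ringMass_nonneg (K P : ℕ) (s : Finset (Fin P)) : 0 ≤ ringMass K P s := by
  unfold ringMass; split_ifs <;> positivity

lemma sum_ringMass_mul (K P : ℕ) (φ : Finset (Fin P) → ℝ) :
    ∑ s, ringMass K P s * φ s =
      (∑ s ∈ powersetCard K univ, φ s) / (P.choose K : ℝ) := by
  have : (powersetCard K univ : Finset (Finset (Fin P))) = univ.filter (fun s => s.card = K) := by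
    ext s; simp [mem_powersetCard]
  rw [this, Finset.sum_filter, Finset.sum_div]
  refine Finset.sum_congr rfl fun s _ => ?_
  unfold ringMass
  split_ifs <;> simp [div_eq_inv_mul]

lemma sum_ringMass {K P : ℕ} (h : K ≤ P) : ∑ s, ringMass K P s = 1 := by
  have := sum_ringMass_mul K P (fun _ => 1)
  have hpos : (0 : ℝ) < P.choose K := by exact_mod_cast Nat.choose_pos h
  simpa [hpos.ne'] using this

lemma sum_ringMass_mul_le {K P : ℕ} {φ ψ : Finset (Fin P) → ℝ}
    (h : ∀ s, s.card = K → φ s ≤ ψ s) :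
    ∑ s, ringMass K P s * φ s ≤ ∑ s, ringMass K P s * ψ s := by
  refine Finset.sum_le_sum fun s _ => ?_
  by_cases hs : s.card = K
  · exact mul_le_mul_of_nonneg_left (h s hs) (ringMass_nonneg K P s)
  · simp [ringMass, hs]

lemma card_powersetCard_filter_superset {α : Type*} [DecidableEq α] {T a : Finset α}
    (hT : T ⊆ a) {k : ℕ} (hk : T.card ≤ k) :
    ((powersetCard k a).filter (fun s => T ⊆ s)).card =
      (a.card - T.card).choose (k - T.card) := by
  rw [← Finset.card_sdiff_of_subset hT, ← Finset.card_powersetCard]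
  refine Finset.card_nbij' (fun s => s \ T) (fun s => s ∪ T) ?_ ?_ ?_ ?_
  · intro s hs
    simp only [coe_filter, mem_powersetCard, Set.mem_ofPred_eq] at hs
    simp only [mem_coe, mem_powersetCard]
    exact ⟨sdiff_subset_sdiff hs.1.1 subset_rfl, by
      rw [Finset.card_sdiff_of_subset hs.2, hs.1.2]⟩
  · intro s hs
    simp only [mem_coe, mem_powersetCard] at hs
    have hd : Disjoint s T := disjoint_of_subset_left hs.1 sdiff_disjoint
    simp only [coe_filter, mem_powersetCard, Set.mem_ofPred_eq]
    refine ⟨⟨union_subset (hs.1.trans sdiff_subset) hT, ?_⟩, subset_union_right⟩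
    rw [card_union_of_disjoint hd]; omega
  · intro s hs
    simp only [coe_filter, mem_powersetCard, Set.mem_ofPred_eq] at hs
    exact sdiff_union_of_subset hs.2
  · intro s hs
    simp only [mem_coe, mem_powersetCard] at hs
    have hd : Disjoint s T := disjoint_of_subset_left hs.1 sdiff_disjoint
    exact union_sdiff_cancel_right hd

/-- The probability that a uniform `K`-element key ring contains `j` given keys. -/
noncomputable def containProb (K P j : ℕ) : ℝ :=
  ∏ i ∈ range j, ((K - i : ℕ) : ℝ) / ((P - i : ℕ) : ℝ)

lemma containProb_succ (K P j : ℕ) : containProb K P (j + 1) =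
    containProb K P j * (((K - j : ℕ) : ℝ) / ((P - j : ℕ) : ℝ)) :=
  Finset.prod_range_succ _ _

lemma choose_sub_div_choose {K P : ℕ} (hKP : K ≤ P) {j : ℕ} (hj : j ≤ K) :
    ((P - j).choose (K - j) : ℝ) / (P.choose K : ℝ) = containProb K P j := by
  have hpos : (0 : ℝ) < P.choose K := by exact_mod_cast Nat.choose_pos hKP
  induction j with
  | zero => simp [containProb, hpos.ne']
  | succ j ih =>
    rw [containProb_succ, ← ih (by omega)]
    obtain ⟨a, ha⟩ : ∃ a, P - j = a + 1 := ⟨P - j - 1, by omega⟩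
    obtain ⟨b, hb⟩ : ∃ b, K - j = b + 1 := ⟨K - j - 1, by omega⟩
    have ha' : P - (j + 1) = a := by omega
    have hb' : K - (j + 1) = b := by omega
    rw [ha, hb, ha', hb']
    have := Nat.add_one_mul_choose_eq a b
    have h2 : ((a : ℝ) + 1) * (a.choose b : ℝ) = ((a + 1).choose (b + 1) : ℝ) * (b + 1) := by
      exact_mod_cast this
    push_cast
    have : (a : ℝ) + 1 ≠ 0 := by positivity
    field_simp
    linarith

lemma sum_ringMass_superset {K P : ℕ} (hKP : K ≤ P) {T : Finset (Fin P)} (hT : T.card ≤ K) :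
    ∑ s, ringMass K P s * (if T ⊆ s then 1 else 0) = containProb K P T.card := by
  rw [sum_ringMass_mul, ← choose_sub_div_choose hKP hT, Finset.sum_boole,
    card_powersetCard_filter_superset (subset_univ T) hT]
  simp

lemma containProb_nonneg (K P j : ℕ) : 0 ≤ containProb K P j :=
  Finset.prod_nonneg fun _ _ => by positivity

lemma containProb_le_pow {K P : ℕ} (hK : 1 ≤ K) (hKP : K ≤ P) (j : ℕ) :
    containProb K P j ≤ ((K : ℝ) / P) ^ j := by
  have : ((K : ℝ) / P) ^ j = ∏ _i ∈ range j, (K : ℝ) / P := by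
    rw [Finset.prod_const, Finset.card_range]
  rw [this, containProb]
  refine Finset.prod_le_prod (fun _ _ => by positivity) fun i _ => ?_
  rcases le_or_gt K i with h | h
  · simp [Nat.sub_eq_zero_of_le h]; positivity
  · rw [Nat.cast_sub h.le, Nat.cast_sub (by omega)]
    have h1 : (i : ℝ) < K := by exact_mod_cast h
    have h2 : (K : ℝ) ≤ P := by exact_mod_cast hKP
    rw [div_le_div_iff₀ (by linarith) (by linarith [(Nat.cast_nonneg i : (0 : ℝ) ≤ i)])]
    nlinarith [(Nat.cast_nonneg i : (0 : ℝ) ≤ i)]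

lemma pow_le_containProb {K P q : ℕ} (hq : 1 ≤ q) (hK : 2 * q ≤ K) (hKP : K ≤ P) :
    ((K : ℝ) / (2 * P)) ^ q ≤ containProb K P q := by
  have : ((K : ℝ) / (2 * P)) ^ q = ∏ _i ∈ range q, (K : ℝ) / (2 * P) := by
    rw [Finset.prod_const, Finset.card_range]
  rw [this, containProb]
  refine Finset.prod_le_prod (fun _ _ => by positivity) fun i hi => ?_
  have hi := mem_range.1 hi
  rw [Nat.cast_sub (by omega), Nat.cast_sub (by omega)]
  have h1 : (2 : ℝ) * i ≤ K := by exact_mod_cast (by omega : 2 * i ≤ K)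
  have h2 : (K : ℝ) ≤ P := by exact_mod_cast hKP
  have h3 : (i : ℝ) < K := by exact_mod_cast (by omega : i < K)
  rw [div_le_div_iff₀ (by linarith [(Nat.cast_nonneg i : (0 : ℝ) ≤ i)]) (by linarith)]
  nlinarith [(Nat.cast_nonneg i : (0 : ℝ) ≤ i)]

lemma card_filter_inter_eq {K P : ℕ} {a : Finset (Fin P)} (ha : a.card = K) {u : ℕ} (hu : u ≤ K) :
    ((powersetCard K univ).filter (fun s => (s ∩ a).card = u)).card =
      K.choose u * (P - K).choose (K - u) := by
  have hc : (aᶜ).card = P - K := by rw [card_compl, ha, Fintype.card_fin]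
  rw [← hc]
  nth_rewrite 2 [← ha]
  rw [← Finset.card_powersetCard, ← Finset.card_powersetCard, ← Finset.card_product]
  refine Finset.card_nbij' (fun s => (s ∩ a, s \ a)) (fun x => x.1 ∪ x.2) ?_ ?_ ?_ ?_
  · intro s hs
    simp only [coe_filter, mem_powersetCard, Set.mem_ofPred_eq] at hs
    simp only [coe_product, Set.mem_prod, mem_coe, mem_powersetCard]
    refine ⟨⟨inter_subset_right, hs.2⟩, fun x hx => by simp_all, ?_⟩
    have := Finset.card_inter_add_card_sdiff s a
    omega
  · rintro ⟨x, y⟩ hxy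
    simp only [coe_product, Set.mem_prod, mem_coe, mem_powersetCard] at hxy
    obtain ⟨⟨hx, hxc⟩, hy, hyc⟩ := hxy
    have hd : Disjoint x y := disjoint_of_subset_left hx
      (disjoint_of_subset_right hy disjoint_compl_right)
    have hya : y ∩ a = ∅ := Finset.disjoint_iff_inter_eq_empty.1
      (disjoint_of_subset_left hy disjoint_compl_left)
    simp only [coe_filter, mem_powersetCard, Set.mem_ofPred_eq]
    refine ⟨⟨subset_univ _, by rw [card_union_of_disjoint hd]; omega⟩, ?_⟩
    rw [union_inter_distrib_right, hya, union_empty, inter_eq_left.2 hx, hxc]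
  · intro s _
    dsimp only
    rw [union_comm, sdiff_union_inter]
  · rintro ⟨x, y⟩ hxy
    simp only [coe_product, Set.mem_prod, mem_coe, mem_powersetCard] at hxy
    obtain ⟨⟨hx, hxc⟩, hy, hyc⟩ := hxy
    have hya : y ∩ a = ∅ := Finset.disjoint_iff_inter_eq_empty.1
      (disjoint_of_subset_left hy disjoint_compl_left)
    have hya' : y \ a = y := sdiff_eq_self_of_disjoint
      (disjoint_of_subset_left hy disjoint_compl_left)
    dsimp only
    rw [union_inter_distrib_right, hya, union_empty, inter_eq_left.2 hx, union_sdiff_distrib,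
      hya', sdiff_eq_empty_iff_subset.2 hx, empty_union]

/-- `psq` is the probability that a random key ring shares `q` keys with a given one. -/
lemma sum_ringMass_inter_eq_psq {K P q : ℕ} (hKP : K ≤ P) (hqK : q ≤ K) {a : Finset (Fin P)}
    (ha : a.card = K) :
    ∑ s, ringMass K P s * (if q ≤ (s ∩ a).card then 1 else 0) = psq q K P := by
  have h1 : ∀ s : Finset (Fin P), (if q ≤ (s ∩ a).card then (1 : ℝ) else 0) =
      1 - ∑ u ∈ range q, if (s ∩ a).card = u then 1 else 0 := by
    intro s
    rw [Finset.sum_ite_eq]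
    by_cases h : q ≤ (s ∩ a).card <;> simp [h, not_lt.2, not_le.1]
  simp only [h1, mul_sub, Finset.sum_sub_distrib, mul_one, sum_ringMass hKP, psq]
  congr 1
  simp only [Finset.mul_sum]
  rw [Finset.sum_comm]
  refine Finset.sum_congr rfl fun u hu => ?_
  rw [sum_ringMass_mul, Finset.sum_boole,
    card_filter_inter_eq ha (by have := mem_range.1 hu; omega)]
  push_cast
  rfl

lemma choose_card_inter {P : ℕ} (a s : Finset (Fin P)) (j : ℕ) :
    (((s ∩ a).card.choose j : ℕ) : ℝ) =
      ∑ T ∈ powersetCard j a, if T ⊆ s then 1 else 0 := by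
  rw [Finset.sum_boole, ← Finset.card_powersetCard]
  congr 2
  ext T
  simp only [mem_powersetCard, mem_filter, subset_inter_iff]
  tauto

lemma sum_ringMass_choose {K P j : ℕ} (hKP : K ≤ P) (hj : j ≤ K) {a : Finset (Fin P)}
    (ha : a.card = K) :
    ∑ s, ringMass K P s * (((s ∩ a).card.choose j : ℕ) : ℝ) =
      K.choose j * containProb K P j := by
  simp only [choose_card_inter, Finset.mul_sum]
  rw [Finset.sum_comm]
  have : ∀ T ∈ powersetCard j a,
      ∑ s, ringMass K P s * (if T ⊆ s then 1 else 0) = containProb K P j := by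
    intro T hT
    have hc := (mem_powersetCard.1 hT).2
    rw [sum_ringMass_superset hKP (by omega), hc]
  rw [Finset.sum_congr rfl this]
  simp [ha]

lemma choose_mul_containProb_le_psq {K P q : ℕ} (hKP : K ≤ P) (hqK : q + 1 ≤ K) :
    (1 - (K : ℝ) ^ 2 / P) * (K.choose q * containProb K P q) ≤ psq q K P := by
  obtain ⟨a, -, ha⟩ := Finset.exists_subset_card_eq
    (s := (univ : Finset (Fin P))) (n := K) (by simpa using hKP)
  have key : ∀ s : Finset (Fin P), s.card = K →
      (((s ∩ a).card.choose q : ℕ) : ℝ) - (q + 1) * (((s ∩ a).card.choose (q + 1) : ℕ) : ℝ) ≤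
      if q ≤ (s ∩ a).card then 1 else 0 := by
    intro s _
    have h1 : (((s ∩ a).card.choose (q + 1) : ℕ) : ℝ) * (q + 1) =
        ((s ∩ a).card.choose q : ℕ) * (((s ∩ a).card - q : ℕ) : ℝ) := by
      exact_mod_cast Nat.choose_succ_right_eq (s ∩ a).card q
    split_ifs with h
    · rcases h.eq_or_lt with h | h
      · rw [← h]; simp
      · have h2 : (1 : ℝ) ≤ (((s ∩ a).card - q : ℕ) : ℝ) := by
          exact_mod_cast (by omega : 1 ≤ (s ∩ a).card - q)
        have h3 : (0 : ℝ) ≤ ((s ∩ a).card.choose q : ℕ) := by positivity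
        nlinarith
    · rw [Nat.choose_eq_zero_of_lt (by omega), Nat.choose_eq_zero_of_lt (by omega)]
      simp
  have h := sum_ringMass_mul_le key
  rw [sum_ringMass_inter_eq_psq hKP (by omega) ha] at h
  refine le_trans ?_ h
  simp only [mul_sub, Finset.sum_sub_distrib, mul_left_comm (ringMass K P _) ((q : ℝ) + 1)]
  rw [← Finset.mul_sum, sum_ringMass_choose hKP (by omega) ha, sum_ringMass_choose hKP hqK ha,
    containProb_succ]
  have h1 : (K.choose (q + 1) : ℝ) * (q + 1) = K.choose q * ((K - q : ℕ) : ℝ) := by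
    exact_mod_cast Nat.choose_succ_right_eq K q
  have h0 : 0 ≤ (K.choose q : ℝ) * containProb K P q :=
    mul_nonneg (by positivity) (containProb_nonneg _ _ _)
  have h2 : ((K - q : ℕ) : ℝ) * (((K - q : ℕ) : ℝ) / ((P - q : ℕ) : ℝ)) ≤ (K : ℝ) ^ 2 / P := by
    rw [Nat.cast_sub (by omega), Nat.cast_sub (by omega), mul_div_assoc']
    have hq' : (q : ℝ) < K := by exact_mod_cast (by omega : q < K)
    have hP' : (K : ℝ) ≤ P := by exact_mod_cast hKP
    have hq0 : (0 : ℝ) ≤ q := by positivity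
    rw [div_le_div_iff₀ (by linarith) (by linarith)]
    nlinarith [mul_nonneg hq0 (sub_nonneg.2 hP'), mul_nonneg hq0 (sub_nonneg.2 hq'.le),
      mul_nonneg (mul_nonneg hq0 (sub_nonneg.2 hq'.le)) (sub_nonneg.2 hP'),
      mul_nonneg (mul_nonneg hq0 (by linarith : (0:ℝ) ≤ K)) (sub_nonneg.2 hP'),
      mul_nonneg hq0 (mul_nonneg (sub_nonneg.2 hq'.le) (by linarith : (0:ℝ) ≤ K))]
  calc _ = (K.choose q : ℝ) * containProb K P q -
        (K : ℝ) ^ 2 / P * (K.choose q * containProb K P q) := by ring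
    _ ≤ (K.choose q : ℝ) * containProb K P q -
        ((K - q : ℕ) : ℝ) * (((K - q : ℕ) : ℝ) / ((P - q : ℕ) : ℝ)) *
          (K.choose q * containProb K P q) :=
        sub_le_sub_left (mul_le_mul_of_nonneg_right h2 h0) _
    _ = _ := by linear_combination containProb K P q * (((K - q : ℕ) : ℝ) / ((P - q : ℕ) : ℝ)) * h1

lemma psq_nonneg {K P q : ℕ} (hKP : K ≤ P) (hqK : q ≤ K) : 0 ≤ psq q K P := by
  obtain ⟨a, -, ha⟩ := Finset.exists_subset_card_eq
    (s := (univ : Finset (Fin P))) (n := K) (by simpa using hKP)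
  rw [← sum_ringMass_inter_eq_psq hKP hqK ha]
  exact Finset.sum_nonneg fun s _ => mul_nonneg (ringMass_nonneg _ _ _) (by split_ifs <;> simp)

end KeyRings

section TwoRings

/-- The probability that a random key ring shares at least `q` keys with each of `a` and `b`. -/
noncomputable def commonProb (q K P : ℕ) (a b : Finset (Fin P)) : ℝ :=
  ∑ s, ringMass K P s *
    ((if q ≤ (s ∩ a).card then 1 else 0) * (if q ≤ (s ∩ b).card then 1 else 0))

lemma commonProb_nonneg (q K P : ℕ) (a b : Finset (Fin P)) : 0 ≤ commonProb q K P a b :=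
  Finset.sum_nonneg fun s _ => mul_nonneg (ringMass_nonneg _ _ _) (by split_ifs <;> simp)

lemma commonProb_le_psq {K P q : ℕ} (hKP : K ≤ P) (hqK : q ≤ K) {a : Finset (Fin P)}
    (ha : a.card = K) (b : Finset (Fin P)) : commonProb q K P a b ≤ psq q K P := by
  rw [← sum_ringMass_inter_eq_psq hKP hqK ha]
  exact sum_ringMass_mul_le fun s _ => by split_ifs <;> simp

lemma card_powersetCard_filter_meets {α : Type*} [DecidableEq α] (a b : Finset α) {q : ℕ}
    (hq : 1 ≤ q) :
    ((powersetCard q a).filter (fun T => (T ∩ b).Nonempty)).card ≤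
      (a ∩ b).card * (a.card - 1).choose (q - 1) := by
  have hsub : (powersetCard q a).filter (fun T => (T ∩ b).Nonempty) ⊆
      (a ∩ b).biUnion fun k => (powersetCard q a).filter (fun T => {k} ⊆ T) := by
    intro T hT
    obtain ⟨hT, k, hk⟩ := mem_filter.1 hT
    have hk := mem_inter.1 hk
    have hTa := (mem_powersetCard.1 hT).1
    exact mem_biUnion.2 ⟨k, mem_inter.2 ⟨hTa hk.1, hk.2⟩,
      mem_filter.2 ⟨hT, singleton_subset_iff.2 hk.1⟩⟩
  refine (card_le_card hsub).trans (card_biUnion_le_card_mul _ _ _ fun k hk => ?_)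
  rw [card_powersetCard_filter_superset (singleton_subset_iff.2 (mem_inter.1 hk).1) (by simpa)]
  simp

lemma commonProb_le_containProb {K P q : ℕ} (hq : 1 ≤ q) (hqK : 2 * q ≤ K) (hKP : K ≤ P)
    {a b : Finset (Fin P)} (ha : a.card = K) (hb : b.card = K) :
    commonProb q K P a b ≤
      (a ∩ b).card * ((K - 1).choose (q - 1) * containProb K P q) +
        (K.choose q : ℝ) ^ 2 * containProb K P (2 * q) := by
  set M := (powersetCard q a).filter (fun T => (T ∩ b).Nonempty) with hM
  set D := (powersetCard q a ×ˢ powersetCard q b).filter (fun x => Disjoint x.1 x.2) with hD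
  have key : ∀ s : Finset (Fin P), s.card = K →
      ((if q ≤ (s ∩ a).card then (1 : ℝ) else 0) * (if q ≤ (s ∩ b).card then 1 else 0)) ≤
      ∑ T ∈ M, (if T ⊆ s then 1 else 0) + ∑ x ∈ D, (if x.1 ∪ x.2 ⊆ s then 1 else 0) := by
    intro s _
    have n1 : (0 : ℝ) ≤ ∑ T ∈ M, (if T ⊆ s then 1 else 0) :=
      Finset.sum_nonneg fun _ _ => by split_ifs <;> simp
    have n2 : (0 : ℝ) ≤ ∑ x ∈ D, (if x.1 ∪ x.2 ⊆ s then 1 else 0) :=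
      Finset.sum_nonneg fun _ _ => by split_ifs <;> simp
    by_cases h1 : q ≤ (s ∩ a).card; swap
    · simp only [h1, if_false, zero_mul]; positivity
    by_cases h2 : q ≤ (s ∩ b).card; swap
    · simp only [h2, if_false, mul_zero]; positivity
    simp only [h1, h2, if_true, mul_one]
    obtain ⟨T, hT, hTc⟩ := exists_subset_card_eq h1
    obtain ⟨T', hT', hTc'⟩ := exists_subset_card_eq h2
    rw [subset_inter_iff] at hT hT'
    by_cases hd : Disjoint T T'
    · have hmem : (T, T') ∈ D := mem_filter.2 ⟨mem_product.2
        ⟨mem_powersetCard.2 ⟨hT.2, hTc⟩, mem_powersetCard.2 ⟨hT'.2, hTc'⟩⟩, hd⟩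
      have := Finset.single_le_sum (f := fun x : Finset (Fin P) × Finset (Fin P) =>
        if x.1 ∪ x.2 ⊆ s then (1 : ℝ) else 0) (fun _ _ => by split_ifs <;> simp) hmem
      simp only [union_subset hT.1 hT'.1, if_true] at this
      linarith
    · obtain ⟨k, hk, hk'⟩ := not_disjoint_iff.1 hd
      have hmem : T ∈ M := mem_filter.2 ⟨mem_powersetCard.2 ⟨hT.2, hTc⟩,
        k, mem_inter.2 ⟨hk, hT'.2 hk'⟩⟩
      have := Finset.single_le_sum (f := fun x : Finset (Fin P) =>
        if x ⊆ s then (1 : ℝ) else 0) (fun _ _ => by split_ifs <;> simp) hmem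
      simp only [hT.1, if_true] at this
      linarith
  refine (sum_ringMass_mul_le key).trans ?_
  simp only [mul_add, Finset.sum_add_distrib, Finset.mul_sum]
  rw [Finset.sum_comm (s := univ) (t := M), Finset.sum_comm (s := univ) (t := D)]
  have e1 : ∀ T ∈ M, ∑ s, ringMass K P s * (if T ⊆ s then 1 else 0) = containProb K P q := by
    intro T hT
    have hc := (mem_powersetCard.1 (mem_filter.1 hT).1).2
    rw [sum_ringMass_superset hKP (by omega), hc]
  have e2 : ∀ x ∈ D, ∑ s, ringMass K P s * (if x.1 ∪ x.2 ⊆ s then 1 else 0) =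
      containProb K P (2 * q) := by
    intro x hx
    obtain ⟨hx, hd⟩ := mem_filter.1 hx
    obtain ⟨h1, h2⟩ := mem_product.1 hx
    have hc : (x.1 ∪ x.2).card = 2 * q := by
      rw [card_union_of_disjoint hd, (mem_powersetCard.1 h1).2, (mem_powersetCard.1 h2).2]; omega
    rw [sum_ringMass_superset hKP (by omega), hc]
  rw [Finset.sum_congr rfl e1, Finset.sum_congr rfl e2, Finset.sum_const, Finset.sum_const,
    nsmul_eq_mul, nsmul_eq_mul, ← mul_assoc]
  have c1 : (M.card : ℝ) ≤ (a ∩ b).card * (K - 1).choose (q - 1) := by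
    have := card_powersetCard_filter_meets a b hq
    rw [ha] at this
    exact_mod_cast this
  have c2 : (D.card : ℝ) ≤ (K.choose q : ℝ) ^ 2 := by
    have : D.card ≤ K.choose q * K.choose q := by
      refine (card_filter_le _ _).trans ?_
      rw [card_product, card_powersetCard, card_powersetCard, ha, hb]
    rw [pow_two]
    exact_mod_cast this
  exact add_le_add (mul_le_mul_of_nonneg_right c1 (containProb_nonneg _ _ _))
    (mul_le_mul_of_nonneg_right c2 (containProb_nonneg _ _ _))

lemma choose_mul_containProb_le_two_mul_psq {K P q : ℕ} (hKP : K ≤ P) (hqK : q + 1 ≤ K)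
    (hx : (K : ℝ) ^ 2 / P ≤ 1 / 2) :
    K.choose q * containProb K P q ≤ 2 * psq q K P := by
  have h1 := choose_mul_containProb_le_psq hKP hqK
  have h0 : 0 ≤ (K.choose q : ℝ) * containProb K P q :=
    mul_nonneg (by positivity) (containProb_nonneg _ _ _)
  nlinarith

lemma containProb_two_mul_le {K P q : ℕ} (hq : 1 ≤ q) (hqK : 2 * q ≤ K) (hKP : K ≤ P) :
    containProb K P (2 * q) ≤ 4 ^ q * containProb K P q ^ 2 := by
  have h1 := containProb_le_pow (by omega) hKP (2 * q)
  have h2 := pow_le_containProb hq hqK hKP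
  have h3 : ((K : ℝ) / P) ^ (2 * q) = 4 ^ q * (((K : ℝ) / (2 * P)) ^ q) ^ 2 := by
    rw [← pow_mul, mul_comm q 2, pow_mul, pow_mul, ← mul_pow]
    congr 1
    have : (0 : ℝ) < P := by exact_mod_cast (by omega : 0 < P)
    field_simp
    norm_num
  rw [h3] at h1
  refine h1.trans ?_
  gcongr

lemma commonProb_le {K P q : ℕ} (hq : 1 ≤ q) (hqK : 2 * q ≤ K) (hKP : K ≤ P)
    (hx : (K : ℝ) ^ 2 / P ≤ 1 / 2)
    {a b : Finset (Fin P)} (ha : a.card = K) (hb : b.card = K) :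
    commonProb q K P a b ≤
      2 * q / K * (a ∩ b).card * psq q K P + 4 ^ (q + 1) * psq q K P ^ 2 := by
  refine (commonProb_le_containProb hq hqK hKP ha hb).trans ?_
  have hc := choose_mul_containProb_le_two_mul_psq (q := q) hKP (by omega) hx
  have h0 : 0 ≤ (K.choose q : ℝ) * containProb K P q :=
    mul_nonneg (by positivity) (containProb_nonneg _ _ _)
  have hK : (0 : ℝ) < K := by exact_mod_cast (by omega : 0 < K)
  have habs : ((K - 1).choose (q - 1) : ℝ) = q / K * K.choose q := by
    have h1 := Nat.add_one_mul_choose_eq (K - 1) (q - 1)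
    rw [Nat.sub_add_cancel (by omega), Nat.sub_add_cancel hq] at h1
    have h2 : (K : ℝ) * (K - 1).choose (q - 1) = K.choose q * q := by exact_mod_cast h1
    field_simp
    linarith
  refine add_le_add ?_ ?_
  · rw [habs]
    calc ((a ∩ b).card : ℝ) * (q / K * K.choose q * containProb K P q)
        = q / K * (a ∩ b).card * (K.choose q * containProb K P q) := by ring
      _ ≤ q / K * (a ∩ b).card * (2 * psq q K P) := by gcongr
      _ = _ := by ring
  · calc (K.choose q : ℝ) ^ 2 * containProb K P (2 * q)
        ≤ (K.choose q : ℝ) ^ 2 * (4 ^ q * containProb K P q ^ 2) := by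
          gcongr; exact containProb_two_mul_le hq hqK hKP
      _ = 4 ^ q * (K.choose q * containProb K P q) ^ 2 := by ring
      _ ≤ 4 ^ q * (2 * psq q K P) ^ 2 := by gcongr
      _ = _ := by ring

lemma pow_le_psq {K P q : ℕ} (hq : 1 ≤ q) (hqK : 2 * q ≤ K) (hKP : K ≤ P)
    (hx : (K : ℝ) ^ 2 / P ≤ 1 / 2) :
    ((K : ℝ) ^ 2 / P) ^ q ≤ 2 * (4 * q) ^ q * psq q K P := by
  have hc := choose_mul_containProb_le_two_mul_psq (q := q) hKP (by omega) hx
  have h1 := pow_le_containProb hq hqK hKP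
  have hq' : (0 : ℝ) < q := by exact_mod_cast hq
  have h2 : ((K : ℝ) / (2 * q)) ^ q ≤ K.choose q := by
    refine le_trans ?_ (Nat.pow_le_choose q K)
    rw [← div_div, div_pow]
    have h3 : (K : ℝ) / 2 ≤ ((K + 1 - q : ℕ) : ℝ) := by
      rw [div_le_iff₀ two_pos]
      exact_mod_cast (by omega : K ≤ (K + 1 - q) * 2)
    have h4 : (q.factorial : ℝ) ≤ (q : ℝ) ^ q := by exact_mod_cast Nat.factorial_le_pow q
    gcongr
  have hP : (0 : ℝ) < P := by exact_mod_cast (by omega : 0 < P)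
  calc ((K : ℝ) ^ 2 / P) ^ q =
        (4 * q) ^ q * (((K : ℝ) / (2 * q)) ^ q * ((K : ℝ) / (2 * P)) ^ q) := by
        rw [← mul_pow, ← mul_pow]; congr 1; field_simp; norm_num
    _ ≤ (4 * q) ^ q * (K.choose q * containProb K P q) := by gcongr
    _ ≤ (4 * q) ^ q * (2 * psq q K P) := by gcongr
    _ = _ := by ring

/-- The generating function of the number of common keys. -/
lemma sum_ringMass_mul_pow_le {K P : ℕ} (hK : 1 ≤ K) (hKP : K ≤ P) {a : Finset (Fin P)}
    (ha : a.card = K) {y : ℝ} (hy : 1 ≤ y) :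
    ∑ b, ringMass K P b * y ^ (a ∩ b).card ≤ Real.exp ((K : ℝ) ^ 2 / P * (y - 1)) := by
  have e1 : ∀ b : Finset (Fin P), y ^ (a ∩ b).card =
      ∑ T ∈ a.powerset, (y - 1) ^ T.card * (if T ⊆ b then 1 else 0) := by
    intro b
    have := Finset.sum_pow_mul_eq_add_pow (y - 1) 1 (a ∩ b)
    simp only [sub_add_cancel, one_pow, mul_one] at this
    rw [← this]
    simp only [mul_ite, mul_one, mul_zero]
    rw [← Finset.sum_filter]
    refine Finset.sum_congr ?_ fun _ _ => rfl
    ext T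
    rw [mem_powerset, mem_filter, mem_powerset, subset_inter_iff]
  simp only [e1, Finset.mul_sum]
  rw [Finset.sum_comm]
  have e2 : ∀ T ∈ a.powerset,
      ∑ b, ringMass K P b * ((y - 1) ^ T.card * (if T ⊆ b then 1 else 0)) ≤
      ((y - 1) * (K / P)) ^ T.card * 1 ^ (a.card - T.card) := by
    intro T hT
    have hc : T.card ≤ K := ha ▸ card_le_card (mem_powerset.1 hT)
    simp only [mul_left_comm (ringMass K P _)]
    rw [← Finset.mul_sum, sum_ringMass_superset hKP hc, mul_pow, one_pow, mul_one]
    exact mul_le_mul_of_nonneg_left (containProb_le_pow hK hKP _)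
      (pow_nonneg (by linarith) _)
  refine (Finset.sum_le_sum e2).trans ?_
  rw [Finset.sum_pow_mul_eq_add_pow, ha]
  have h0 : 0 ≤ (y - 1) * ((K : ℝ) / P) := mul_nonneg (by linarith) (by positivity)
  calc ((y - 1) * ((K : ℝ) / P) + 1) ^ K ≤ Real.exp ((y - 1) * ((K : ℝ) / P)) ^ K := by
        gcongr; exact Real.add_one_le_exp _
    _ = _ := by rw [← Real.exp_nat_mul]; congr 1; ring

end TwoRings

section Attachment

lemma weight_nonneg {n K P : ℕ} {p : ℝ} (hp0 : 0 ≤ p) (hp1 : p ≤ 1) (ω : Config n P) :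
    0 ≤ weight n K P p ω := by
  refine mul_nonneg (Finset.prod_nonneg fun i _ => ?_) (Finset.prod_nonneg fun e _ => ?_)
  · split_ifs <;> positivity
  · split_ifs <;> linarith

lemma prob_nonneg {n K P : ℕ} {p : ℝ} (hp0 : 0 ≤ p) (hp1 : p ≤ 1) (E : Set (Config n P)) :
    0 ≤ prob n K P p E :=
  Finset.sum_nonneg fun _ _ => Set.indicator_nonneg (fun ω _ => weight_nonneg hp0 hp1 ω) _

lemma prob_le_sum_prob {n K P : ℕ} {p : ℝ} (hp0 : 0 ≤ p) (hp1 : p ≤ 1) {κ : Type*}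
    (E : Set (Config n P)) (I : Finset κ) (F : κ → Set (Config n P))
    (h : ∀ ω ∈ E, ∃ x ∈ I, ω ∈ F x) :
    prob n K P p E ≤ ∑ x ∈ I, prob n K P p (F x) := by
  classical
  unfold prob
  rw [Finset.sum_comm]
  refine Finset.sum_le_sum fun ω _ => ?_
  have hnn : ∀ G : Set (Config n P), 0 ≤ G.indicator (weight n K P p) ω :=
    fun G => Set.indicator_nonneg (fun ω _ => weight_nonneg hp0 hp1 ω) _
  by_cases hω : ω ∈ E
  · obtain ⟨x, hx, hωx⟩ := h ω hω
    rw [Set.indicator_of_mem hω, ← Set.indicator_of_mem hωx (weight n K P p)]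
    exact Finset.single_le_sum (f := fun x => (F x).indicator (weight n K P p) ω)
      (fun x _ => hnn (F x)) hx
  · rw [Set.indicator_of_notMem hω]
    exact Finset.sum_nonneg fun x _ => hnn (F x)

lemma Adj.symm {q n P : ℕ} {ω : Config n P} {i j : Fin n} (h : Adj q n P ω i j) :
    Adj q n P ω j i :=
  ⟨h.1.symm, by rw [inter_comm]; exact h.2.1, by rw [Sym2.eq_swap]; exact h.2.2⟩

/-- Every vertex `w` of `T` is attached to `f w`, and no other vertex outside `A` is attached
to `A`. -/
def attachEvent (q n P : ℕ) (A T : Finset (Fin n)) (f : Fin n → Fin n) : Set (Config n P) :=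
  {ω | (∀ w ∈ T, Adj q n P ω w (f w)) ∧ ∀ w ∈ Aᶜ \ T, ∀ i ∈ A, ¬ Adj q n P ω w i}

/-- Conditional probability, given the key rings, that a vertex `w` behaves as prescribed by
`attachEvent`. -/
noncomputable def attachFactor {n P : ℕ} (q : ℕ) (p : ℝ) (A T : Finset (Fin n))
    (f : Fin n → Fin n) (w : Fin n) (S : Fin n → Finset (Fin P)) (s : Finset (Fin P)) : ℝ :=
  if w ∈ T then p * (if q ≤ (s ∩ S (f w)).card then 1 else 0)
  else ∏ i ∈ A, (1 - p * (if q ≤ (s ∩ S i).card then 1 else 0))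

lemma prob_attachEvent_le_sum {n q K P : ℕ} {p : ℝ} (hp0 : 0 ≤ p) (hp1 : p ≤ 1)
    {A T : Finset (Fin n)} {f : Fin n → Fin n} (hf : ∀ w ∈ T, f w ∈ A) :
    prob n K P p (attachEvent q n P A T f) ≤
      ∑ S : Fin n → Finset (Fin P), (∏ i, ringMass K P (S i)) *
        ∏ w ∈ Aᶜ, attachFactor q p A T f w S (S w) := by
  set chan : Bool → ℝ := fun b => if b then p else 1 - p with hchan
  have hchan1 : ∑ b, chan b = 1 := by simp [hchan]
  let F : (Fin n → Finset (Fin P)) → Fin n × Fin n → Bool → ℝ := fun S x b =>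
    if x.1 ∈ T then
      if x.2 = f x.1 then (if q ≤ (S x.1 ∩ S x.2).card ∧ b = true then 1 else 0) else 1
    else if q ≤ (S x.1 ∩ S x.2).card ∧ b = true then 0 else 1
  have hF0 : ∀ S x b, 0 ≤ F S x b := by
    intro S x b
    dsimp only [F]
    split_ifs <;> simp
  have hinj : Set.InjOn (fun x : Fin n × Fin n => s(x.1, x.2)) ((Aᶜ ×ˢ A : Finset _) : Set _) := by
    rintro ⟨w, i⟩ h ⟨w', i'⟩ h' he
    simp only [coe_product, Set.mem_prod, mem_coe, mem_compl] at h h'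
    rcases Sym2.eq_iff.1 he with ⟨h1, h2⟩ | ⟨h1, h2⟩
    · exact Prod.ext h1 h2
    · have hw : w = i' := h1
      exact absurd (hw ▸ h'.2) h.1
  have hle : ∀ S c, (attachEvent q n P A T f).indicator (weight n K P p) (S, c) ≤
      (∏ i, ringMass K P (S i)) * ((∏ e, chan (c e)) *
        ∏ x ∈ Aᶜ ×ˢ A, F S x (c s(x.1, x.2))) := by
    intro S c
    rw [← mul_assoc]
    change _ ≤ weight n K P p (S, c) * _
    have hw := weight_nonneg (K := K) hp0 hp1 (S, c)
    by_cases hE : (S, c) ∈ attachEvent q n P A T f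
    · rw [Set.indicator_of_mem hE, Finset.prod_eq_one, mul_one]
      rintro ⟨w, i⟩ hx
      obtain ⟨hwA, hiA⟩ := mem_product.1 hx
      have hne : w ≠ i := by rintro rfl; exact mem_compl.1 hwA hiA
      dsimp only [F]
      by_cases hT : w ∈ T
      · have := hE.1 w hT
        rw [if_pos hT]
        split_ifs with h1 h2
        · rfl
        · subst h1; exact absurd ⟨this.2.1, this.2.2⟩ h2
        · rfl
      · have := hE.2 w (mem_sdiff.2 ⟨hwA, hT⟩) i hiA
        rw [if_neg hT, if_neg fun h => this ⟨hne, h.1, h.2⟩]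
    · rw [Set.indicator_of_notMem hE]
      exact mul_nonneg hw (Finset.prod_nonneg fun x _ => hF0 _ _ _)
  unfold prob
  rw [Fintype.sum_prod_type]
  refine Finset.sum_le_sum fun S _ => ?_
  refine (Finset.sum_le_sum fun c _ => hle S c).trans (le_of_eq ?_)
  rw [← Finset.mul_sum, sum_prod_mul_prod_comp chan hchan1 _ _ hinj, Finset.prod_product]
  congr 1
  refine Finset.prod_congr rfl fun w hw => ?_
  unfold attachFactor
  by_cases hT : w ∈ T
  · rw [if_pos hT, ← Finset.prod_ite_eq_of_mem' A (f w)
      (fun i => p * if q ≤ (S w ∩ S i).card then 1 else 0) (hf w hT)]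
    refine Finset.prod_congr rfl fun i _ => ?_
    by_cases h1 : i = f w
    · subst h1
      by_cases h2 : q ≤ (S w ∩ S (f w)).card <;> simp [F, hT, h2, hchan]
    · simp [F, hT, h1, hchan]
  · rw [if_neg hT]
    refine Finset.prod_congr rfl fun i _ => ?_
    by_cases h2 : q ≤ (S w ∩ S i).card <;> simp [F, hT, h2, hchan]

lemma prod_one_sub_le {ι : Type*} [DecidableEq ι] (A : Finset ι) (y : ι → ℝ)
    (h0 : ∀ i, 0 ≤ y i) (h1 : ∀ i, y i ≤ 1) :
    ∏ i ∈ A, (1 - y i) ≤ 1 - ∑ i ∈ A, y i + ∑ x ∈ A.offDiag, y x.1 * y x.2 := by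
  induction A using Finset.induction_on with
  | empty => simp
  | insert a A ha ih =>
    rw [Finset.prod_insert ha, Finset.sum_insert ha]
    have hd : Disjoint A.offDiag ({a} ×ˢ A) := by
      refine Finset.disjoint_left.2 fun x hx hx' => ha ?_
      have e := mem_singleton.1 (mem_product.1 hx').1
      exact e ▸ (mem_offDiag.1 hx).1
    have hsub : A.offDiag ∪ {a} ×ˢ A ⊆ (insert a A).offDiag := by
      intro x hx
      rcases mem_union.1 hx with hx | hx
      · exact offDiag_mono (subset_insert a A) hx
      · obtain ⟨h1, h2⟩ := mem_product.1 hx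
        have e := mem_singleton.1 h1
        refine mem_offDiag.2 ⟨e ▸ mem_insert_self _ _, mem_insert_of_mem h2, ?_⟩
        rintro h
        exact ha (e ▸ h ▸ h2)
    have hsum : ∑ x ∈ A.offDiag, y x.1 * y x.2 + y a * ∑ i ∈ A, y i ≤
        ∑ x ∈ (insert a A).offDiag, y x.1 * y x.2 := by
      refine le_trans (le_of_eq ?_) (Finset.sum_le_sum_of_subset_of_nonneg hsub
        fun x _ _ => mul_nonneg (h0 _) (h0 _))
      rw [Finset.sum_union hd, Finset.sum_product]
      simp [Finset.mul_sum]
    have hQ : 0 ≤ ∑ x ∈ A.offDiag, y x.1 * y x.2 :=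
      Finset.sum_nonneg fun x _ => mul_nonneg (h0 _) (h0 _)
    have := mul_le_mul_of_nonneg_left ih (sub_nonneg.2 (h1 a))
    nlinarith [mul_nonneg (h0 a) hQ]

lemma sum_ringMass_mul_attachFactor_of_mem {n q K P : ℕ} {p : ℝ} (hKP : K ≤ P) (hqK : q ≤ K)
    {A T : Finset (Fin n)} {f : Fin n → Fin n} {w : Fin n} (hw : w ∈ T)
    {S : Fin n → Finset (Fin P)} (hS : ∀ i, (S i).card = K) :
    ∑ s, ringMass K P s * attachFactor q p A T f w S s = peq q K P p := by
  simp only [attachFactor, if_pos hw, mul_left_comm (ringMass K P _) p]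
  rw [← Finset.mul_sum, sum_ringMass_inter_eq_psq hKP hqK (hS _), peq]

lemma sum_ringMass_mul_attachFactor_of_notMem {n q K P : ℕ} {p : ℝ} (hp0 : 0 ≤ p) (hp1 : p ≤ 1)
    (hKP : K ≤ P) (hqK : q ≤ K)
    {A T : Finset (Fin n)} {f : Fin n → Fin n} {w : Fin n} (hw : w ∉ T)
    {S : Fin n → Finset (Fin P)} (hS : ∀ i, (S i).card = K) :
    ∑ s, ringMass K P s * attachFactor q p A T f w S s ≤
      Real.exp (-(A.card * peq q K P p) +
        p ^ 2 * ∑ x ∈ A.offDiag, commonProb q K P (S x.1) (S x.2)) := by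
  have key : ∀ s : Finset (Fin P), s.card = K → attachFactor q p A T f w S s ≤
      1 - p * (∑ i ∈ A, if q ≤ (s ∩ S i).card then 1 else 0) +
        p ^ 2 * ∑ x ∈ A.offDiag, (if q ≤ (s ∩ S x.1).card then 1 else 0) *
          (if q ≤ (s ∩ S x.2).card then 1 else 0) := by
    intro s _
    rw [attachFactor, if_neg hw]
    refine (prod_one_sub_le A _ (fun i => ?_) (fun i => ?_)).trans (le_of_eq ?_)
    · split_ifs <;> simp [hp0]
    · split_ifs <;> simp [hp1]
    · rw [Finset.mul_sum, Finset.mul_sum]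
      congr 1
      exact Finset.sum_congr rfl fun x _ => by ring
  refine (sum_ringMass_mul_le key).trans (le_trans (le_of_eq ?_) (Real.add_one_le_exp _))
  have e1 : ∑ s, ringMass K P s * (∑ i ∈ A, if q ≤ (s ∩ S i).card then 1 else 0) =
      A.card * psq q K P := by
    simp only [Finset.mul_sum]
    rw [Finset.sum_comm, Finset.sum_congr rfl fun i _ =>
      sum_ringMass_inter_eq_psq hKP hqK (hS i)]
    simp
  have e2 : ∑ s, ringMass K P s * (∑ x ∈ A.offDiag, (if q ≤ (s ∩ S x.1).card then 1 else 0) *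
      (if q ≤ (s ∩ S x.2).card then 1 else 0)) =
      ∑ x ∈ A.offDiag, commonProb q K P (S x.1) (S x.2) := by
    simp only [Finset.mul_sum]
    rw [Finset.sum_comm]
    rfl
  have e3 : ∀ s (X Y : ℝ), ringMass K P s * (1 - p * X + p ^ 2 * Y) =
      ringMass K P s - p * (ringMass K P s * X) + p ^ 2 * (ringMass K P s * Y) := by
    intros; ring
  simp only [e3]
  rw [Finset.sum_add_distrib, Finset.sum_sub_distrib, ← Finset.mul_sum, ← Finset.mul_sum, e1, e2,
    sum_ringMass hKP, peq]
  ring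

lemma sum_prod_ringMass_mul_le {n K P : ℕ} {X Y : (Fin n → Finset (Fin P)) → ℝ}
    (h : ∀ S, (∀ i, (S i).card = K) → X S ≤ Y S) :
    ∑ S : Fin n → Finset (Fin P), (∏ i, ringMass K P (S i)) * X S ≤
      ∑ S : Fin n → Finset (Fin P), (∏ i, ringMass K P (S i)) * Y S := by
  refine Finset.sum_le_sum fun S _ => ?_
  by_cases hS : ∀ i, (S i).card = K
  · exact mul_le_mul_of_nonneg_left (h S hS)
      (Finset.prod_nonneg fun i _ => ringMass_nonneg _ _ _)
  · obtain ⟨i, hi⟩ := not_forall.1 hS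
    have : ∏ i, ringMass K P (S i) = 0 := Finset.prod_eq_zero (mem_univ i) (by simp [ringMass, hi])
    simp [this]

lemma prob_attachEvent_le {n q K P : ℕ} {p : ℝ} (hp0 : 0 ≤ p) (hp1 : p ≤ 1)
    (hKP : K ≤ P) (hqK : q ≤ K)
    {A T : Finset (Fin n)} (hT : T ⊆ Aᶜ) {f : Fin n → Fin n} (hf : ∀ w ∈ T, f w ∈ A) :
    prob n K P p (attachEvent q n P A T f) ≤
      peq q K P p ^ T.card * ∑ S : Fin n → Finset (Fin P), (∏ i, ringMass K P (S i)) *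
        Real.exp ((Aᶜ \ T).card * (-(A.card * peq q K P p) +
          p ^ 2 * ∑ x ∈ A.offDiag, commonProb q K P (S x.1) (S x.2))) := by
  refine (prob_attachEvent_le_sum hp0 hp1 hf).trans ?_
  rw [sum_prod_mul_resample _ (sum_ringMass hKP), Finset.mul_sum]
  · simp only [mul_left_comm (peq q K P p ^ T.card)]
    refine sum_prod_ringMass_mul_le fun S hS => ?_
    rw [← Finset.prod_sdiff hT, mul_comm, Finset.prod_congr rfl fun w hw =>
      sum_ringMass_mul_attachFactor_of_mem hKP hqK hw hS, Finset.prod_const, Real.exp_nat_mul,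
      ← Finset.prod_const (s := Aᶜ \ T)]
    have hpe : 0 ≤ peq q K P p := mul_nonneg hp0 (psq_nonneg hKP hqK)
    refine mul_le_mul_of_nonneg_left (Finset.prod_le_prod (fun w hw => ?_) fun w hw => ?_)
      (pow_nonneg hpe _)
    · refine Finset.sum_nonneg fun s _ => mul_nonneg (ringMass_nonneg _ _ _) ?_
      rw [attachFactor, if_neg (mem_sdiff.1 hw).2]
      exact Finset.prod_nonneg fun i _ => by split_ifs <;> simp [hp1]
    · exact sum_ringMass_mul_attachFactor_of_notMem hp0 hp1 hKP hqK (mem_sdiff.1 hw).2 hS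
  · intro w hw v hv S a s
    have hne : ∀ i ∈ A, i ≠ v := by rintro i hi rfl; exact mem_compl.1 hv hi
    unfold attachFactor
    by_cases hwT : w ∈ T
    · rw [if_pos hwT, if_pos hwT, Function.update_of_ne (hne _ (hf w hwT))]
    · rw [if_neg hwT, if_neg hwT]
      exact Finset.prod_congr rfl fun i hi => by rw [Function.update_of_ne (hne i hi)]

lemma exp_sum_le_one_add_sum_exp {κ : Type*} (I : Finset κ) (v : κ → ℝ) :
    Real.exp (∑ x ∈ I, v x) ≤ 1 + ∑ x ∈ I, Real.exp (I.card * v x) := by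
  rcases I.eq_empty_or_nonempty with rfl | hI
  · simp
  obtain ⟨x, hx, hmax⟩ := Finset.exists_max_image I v hI
  have h1 : ∑ x ∈ I, v x ≤ I.card * v x := by
    simpa using Finset.sum_le_card_nsmul I v (v x) hmax
  have h2 := Finset.single_le_sum (f := fun x => Real.exp (I.card * v x))
    (fun _ _ => (Real.exp_pos _).le) hx
  linarith [Real.exp_le_exp.2 h1]

lemma sum_prod_ringMass_exp_le {n q K P : ℕ} (hKP : K ≤ P) (A : Finset (Fin n)) {r C : ℝ}
    (hC : ∀ a : Finset (Fin P), a.card = K →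
      ∑ b, ringMass K P b * Real.exp (A.offDiag.card * (r * commonProb q K P a b)) ≤ C) :
    ∑ S : Fin n → Finset (Fin P), (∏ i, ringMass K P (S i)) *
      Real.exp (r * ∑ x ∈ A.offDiag, commonProb q K P (S x.1) (S x.2)) ≤
      1 + A.offDiag.card * C := by
  have hone := sum_prod_eq_one (ι := Fin n) (ringMass K P) (sum_ringMass hKP)
  refine (sum_prod_ringMass_mul_le (Y := fun S => 1 + ∑ x ∈ A.offDiag,
    Real.exp (A.offDiag.card * (r * commonProb q K P (S x.1) (S x.2)))) fun S _ => ?_).trans ?_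
  · rw [Finset.mul_sum]
    exact exp_sum_le_one_add_sum_exp _ _
  simp only [mul_add, Finset.sum_add_distrib, mul_one, hone, Finset.mul_sum]
  rw [Finset.sum_comm]
  have : ∀ x ∈ A.offDiag, ∑ S : Fin n → Finset (Fin P), (∏ i, ringMass K P (S i)) *
      Real.exp (A.offDiag.card * (r * commonProb q K P (S x.1) (S x.2))) ≤ C := by
    intro x hx
    have hne := (mem_offDiag.1 hx).2.2
    rw [sum_prod_mul_resample_single (ringMass K P) (sum_ringMass hKP) x.2
      (fun S s => Real.exp (A.offDiag.card * (r * commonProb q K P (S x.1) s)))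
      (fun S a s => by simp only [Function.update_of_ne hne])]
    refine (sum_prod_ringMass_mul_le (Y := fun _ => C) fun S hS => hC _ (hS _)).trans ?_
    rw [← Finset.sum_mul, hone, one_mul]
  have := Finset.sum_le_card_nsmul _ _ _ this
  rw [nsmul_eq_mul] at this
  linarith

end Attachment

section DependencyEvent

lemma card_attached_lt {n q P h : ℕ} {ω : Config n P} {A : Finset (Fin n)}
    {T : Finset (Fin n)} {f : Fin n → Fin n} (hT : T ⊆ Aᶜ)
    (hf : ∀ w ∈ T, f w ∈ A ∧ Adj q n P ω w (f w))
    (hdeg : ∀ i ∈ A, degree q n P ω i = h)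
    (hdep : (∃ i ∈ A, ∃ j ∈ A, Adj q n P ω i j) ∨
      ∃ w ∉ A, ∃ i ∈ A, ∃ j ∈ A, i ≠ j ∧ Adj q n P ω w i ∧ Adj q n P ω w j) :
    T.card < h * A.card := by
  classical
  set D : Finset (Σ _ : Fin n, Fin n) := A.sigma fun i => univ.filter (Adj q n P ω i) with hD
  have hDcard : D.card = h * A.card := by
    rw [hD, card_sigma, Finset.sum_congr rfl (g := fun _ => h), Finset.sum_const, smul_eq_mul,
      mul_comm]
    intro i hi
    rw [← hdeg i hi, degree, Nat.card_eq_fintype_card, Fintype.card_subtype]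
  set g : Fin n → Σ _ : Fin n, Fin n := fun w => ⟨f w, w⟩ with hg
  have hinj : Function.Injective g := fun w w' h => by
    simp only [hg, Sigma.mk.injEq, heq_eq_eq] at h
    exact h.2
  have hmemD : ∀ {i j}, i ∈ A → Adj q n P ω i j → (⟨i, j⟩ : Σ _ : Fin n, Fin n) ∈ D :=
    fun hi hij => mem_sigma.2 ⟨hi, mem_filter.2 ⟨mem_univ _, hij⟩⟩
  have hmemI : ∀ {i j}, (⟨i, j⟩ : Σ _ : Fin n, Fin n) ∈ T.image g → j ∈ T ∧ i = f j := by
    intro i j hij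
    obtain ⟨w, hw, he⟩ := mem_image.1 hij
    simp only [hg, Sigma.mk.injEq, heq_eq_eq] at he
    obtain ⟨h1, h2⟩ := he
    subst h2
    exact ⟨hw, h1.symm⟩
  rw [← hDcard, ← card_image_of_injective T hinj]
  refine card_lt_card ((ssubset_iff_of_subset ?_).2 ?_)
  · intro x hx
    obtain ⟨w, hw, rfl⟩ := mem_image.1 hx
    exact hmemD (hf w hw).1 (hf w hw).2.symm
  · rcases hdep with ⟨i, hi, j, hj, hij⟩ | ⟨w, -, i, hi, j, hj, hne, hwi, hwj⟩
    · exact ⟨⟨i, j⟩, hmemD hi hij, fun hmem => mem_compl.1 (hT (hmemI hmem).1) hj⟩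
    · by_cases hfi : i = f w
      · exact ⟨⟨j, w⟩, hmemD hj hwj.symm, fun hmem => hne (hfi.trans (hmemI hmem).2.symm)⟩
      · exact ⟨⟨i, w⟩, hmemD hi hwi.symm, fun hmem => hfi (hmemI hmem).2⟩

lemma prob_dependency_le {n q K P h : ℕ} {p C : ℝ} (hp0 : 0 ≤ p) (hp1 : p ≤ 1)
    (hKP : K ≤ P) (hqK : q ≤ K) (A : Finset (Fin n)) (hC0 : 0 ≤ C)
    (hC : ∀ a : Finset (Fin P), a.card = K →
      ∑ b, ringMass K P b *
        Real.exp (A.offDiag.card * (n * p ^ 2 * commonProb q K P a b)) ≤ C) :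
    prob n K P p {ω | (∀ i ∈ A, degree q n P ω i = h) ∧
      ((∃ i ∈ A, ∃ j ∈ A, Adj q n P ω i j) ∨
        ∃ w ∉ A, ∃ i ∈ A, ∃ j ∈ A, i ≠ j ∧ Adj q n P ω w i ∧ Adj q n P ω w j)} ≤
      ∑ t ∈ range (h * A.card), (A.card * (n * peq q K P p)) ^ t *
        (Real.exp (-(A.card * (n * peq q K P p))) *
          Real.exp ((A.card + t) * (A.card * peq q K P p)) * (1 + A.offDiag.card * C)) := by
  classical
  have hpe : 0 ≤ peq q K P p := mul_nonneg hp0 (psq_nonneg hKP hqK)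
  let choices : Finset (Fin n) → Finset (Fin n → Fin n) := fun T =>
    Fintype.piFinset fun w => if w ∈ T then A else {w}
  let I : Finset (Σ _ : ℕ, Σ _ : Finset (Fin n), (Fin n → Fin n)) :=
    (range (h * A.card)).sigma fun t => (powersetCard t Aᶜ).sigma choices
  have hcover := prob_le_sum_prob (K := K) hp0 hp1 {ω | (∀ i ∈ A, degree q n P ω i = h) ∧
      ((∃ i ∈ A, ∃ j ∈ A, Adj q n P ω i j) ∨
        ∃ w ∉ A, ∃ i ∈ A, ∃ j ∈ A, i ≠ j ∧ Adj q n P ω w i ∧ Adj q n P ω w j)} I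
      (fun x => attachEvent q n P A x.2.1 x.2.2) (by
    rintro ω ⟨hdeg, hdep⟩
    set T := Aᶜ.filter fun w => ∃ i ∈ A, Adj q n P ω w i with hT
    have hex : ∀ w, ∃ i, (w ∈ T → i ∈ A ∧ Adj q n P ω w i) ∧ (w ∉ T → i = w) := by
      intro w
      by_cases hw : w ∈ T
      · obtain ⟨i, hi⟩ := (mem_filter.1 hw).2
        exact ⟨i, fun _ => hi, fun h => absurd hw h⟩
      · exact ⟨w, fun h => absurd h hw, fun _ => rfl⟩
    choose f hfT hfT' using hex
    have hlt := card_attached_lt (filter_subset _ _) hfT hdeg hdep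
    refine ⟨⟨T.card, T, f⟩, mem_sigma.2 ⟨mem_range.2 hlt, mem_sigma.2
      ⟨mem_powersetCard.2 ⟨filter_subset _ _, rfl⟩, Fintype.mem_piFinset.2 fun w => ?_⟩⟩,
      fun w hw => (hfT w hw).2, fun w hw i hi hwi => ?_⟩
    · dsimp only
      split_ifs with hw
      · exact (hfT w hw).1
      · exact mem_singleton.2 (hfT' w hw)
    · obtain ⟨h1, h2⟩ := mem_sdiff.1 hw
      exact h2 (mem_filter.2 ⟨h1, i, hi, hwi⟩))
  refine hcover.trans ?_
  rw [Finset.sum_sigma]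
  refine Finset.sum_le_sum fun t ht => ?_
  rw [Finset.sum_sigma]
  set B : ℝ := Real.exp (-(A.card * (n * peq q K P p))) *
          Real.exp ((A.card + t) * (A.card * peq q K P p)) * (1 + A.offDiag.card * C) with hB
  have hterm : ∀ T ∈ powersetCard t Aᶜ, ∀ f ∈ choices T,
      prob n K P p (attachEvent q n P A T f) ≤ peq q K P p ^ t * B := by
    intro T hT f hf
    obtain ⟨hTA, hTc⟩ := mem_powersetCard.1 hT
    have hfA : ∀ w ∈ T, f w ∈ A := fun w hw => by
      simpa [hw] using Fintype.mem_piFinset.1 hf w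
    refine (prob_attachEvent_le hp0 hp1 hKP hqK hTA hfA).trans ?_
    rw [hTc]
    refine mul_le_mul_of_nonneg_left ?_ (pow_nonneg hpe _)
    refine le_trans ?_ (mul_le_mul_of_nonneg_left (sum_prod_ringMass_exp_le hKP A hC)
      (by positivity))
    rw [Finset.mul_sum]
    simp only [mul_left_comm (_ * _) (∏ i, ringMass K P _) _]
    refine sum_prod_ringMass_mul_le fun S _ => ?_
    rw [← Real.exp_add, ← Real.exp_add, Real.exp_le_exp]
    have hQ : 0 ≤ ∑ x ∈ A.offDiag, commonProb q K P (S x.1) (S x.2) :=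
      Finset.sum_nonneg fun x _ => commonProb_nonneg _ _ _ _ _
    set Q := ∑ x ∈ A.offDiag, commonProb q K P (S x.1) (S x.2)
    have hN : ((Aᶜ \ T).card : ℝ) = n - A.card - t := by
      have h1 := Finset.card_sdiff_add_card_eq_card hTA
      have h2 := Finset.card_compl_add_card A
      rw [Fintype.card_fin] at h2
      have h3 : (Aᶜ \ T).card + t + A.card = n := by omega
      have h4 : ((Aᶜ \ T).card : ℝ) + t + A.card = n := by exact_mod_cast h3
      linarith
    rw [hN]
    nlinarith [mul_nonneg (by positivity : (0 : ℝ) ≤ A.card + t) (mul_nonneg (sq_nonneg p) hQ)]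
  have hcard : ∀ T ∈ powersetCard t Aᶜ, (choices T).card = A.card ^ t := by
    intro T hT
    rw [Fintype.card_piFinset, ← Finset.prod_subset (subset_univ T)
      (fun w _ hw => by simp [hw]), Finset.prod_congr rfl fun w hw => by rw [if_pos hw],
      Finset.prod_const, (mem_powersetCard.1 hT).2]
  have hB0 : 0 ≤ B := by positivity
  calc ∑ T ∈ powersetCard t Aᶜ, ∑ f ∈ choices T, prob n K P p (attachEvent q n P A T f)
      ≤ ∑ T ∈ powersetCard t Aᶜ, (A.card : ℝ) ^ t * (peq q K P p ^ t * B) := by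
        refine Finset.sum_le_sum fun T hT => ?_
        refine (Finset.sum_le_card_nsmul _ _ _ (hterm T hT)).trans (le_of_eq ?_)
        rw [hcard T hT, nsmul_eq_mul]
        push_cast
        rfl
    _ ≤ (n : ℝ) ^ t * ((A.card : ℝ) ^ t * (peq q K P p ^ t * B)) := by
        rw [Finset.sum_const, nsmul_eq_mul]
        refine mul_le_mul_of_nonneg_right ?_ (by positivity)
        rw [card_powersetCard]
        exact_mod_cast (Nat.choose_le_pow _ _).trans
          (Nat.pow_le_pow_left (by simpa using card_le_univ Aᶜ) t)
    _ = _ := by rw [mul_pow, mul_pow]; ring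

end DependencyEvent

section Asymptotics

lemma sum_ringMass_exp_commonProb_le {q K P n M : ℕ} {p l : ℝ} (hq : 1 ≤ q) (hqK : 2 * q ≤ K)
    (hKP : K ≤ P) (hx : (K : ℝ) ^ 2 / P ≤ 1 / 2) (hp0 : 0 < p) (hp1 : p ≤ 1)
    (hn : 0 < n) (hl : 1 ≤ l)
    (hL : n * peq q K P p ≤ 2 * l) (hKM : (16 * q ^ 2 * M : ℝ) ≤ K)
    (hsmall₁ : 4 ^ (q + 2) * M * (l ^ 2 / n) ≤ 1)
    (hsmall₂ : 4 * (4 * q) ^ q * (l ^ 2 / n) * Real.exp (l / 4) ≤ 1)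
    {a : Finset (Fin P)} (ha : a.card = K) :
    ∑ b, ringMass K P b * Real.exp (M * (n * p ^ 2 * commonProb q K P a b)) ≤
      Real.exp (2 * M + 2) := by
  have hone := sum_ringMass hKP
  have hn' : (0 : ℝ) < n := by exact_mod_cast hn
  have hK' : (0 : ℝ) < K := by exact_mod_cast (by omega : 0 < K)
  have hq' : (0 : ℝ) < q := by exact_mod_cast hq
  have hM : (0 : ℝ) ≤ M := Nat.cast_nonneg M
  have hs0 : 0 ≤ psq q K P := psq_nonneg hKP (by omega)
  rw [peq] at hL
  rcases le_or_gt (p * l) 1 with hcase | hcase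
  · have : ∀ b : Finset (Fin P), b.card = K →
        Real.exp (M * (n * p ^ 2 * commonProb q K P a b)) ≤ Real.exp (2 * M + 2) := by
      intro b _
      rw [Real.exp_le_exp]
      have h1 := commonProb_le_psq hKP (by omega : q ≤ K) ha b
      have h2 : n * p ^ 2 * commonProb q K P a b ≤ 2 := by
        calc n * p ^ 2 * commonProb q K P a b ≤ n * p ^ 2 * psq q K P := by gcongr
          _ = p * (n * (p * psq q K P)) := by ring
          _ ≤ p * (2 * l) := by gcongr
          _ ≤ 2 := by linarith
      nlinarith
    refine (sum_ringMass_mul_le this).trans (le_of_eq ?_)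
    rw [← Finset.sum_mul, hone, one_mul]
  · have hs : psq q K P ≤ 2 * (l ^ 2 / n) := by
      have h1 : n * psq q K P ≤ 2 * l ^ 2 := by
        calc n * psq q K P = 1 * (n * psq q K P) := by ring
          _ ≤ p * l * (n * psq q K P) := by gcongr
          _ = l * (n * (p * psq q K P)) := by ring
          _ ≤ l * (2 * l) := by gcongr
          _ = _ := by ring
      rw [mul_div_assoc', le_div_iff₀ hn']
      linarith
    set y : ℝ := Real.exp (4 * q * M * l / K) with hy
    have hy1 : 1 ≤ y := Real.one_le_exp (by positivity)
    have hxy : (K : ℝ) ^ 2 / P * y ≤ 1 := by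
      refine (pow_le_one_iff_of_nonneg (by positivity) (by omega : q ≠ 0)).1 ?_
      have h1 : y ^ q ≤ Real.exp (l / 4) := by
        rw [hy, ← Real.exp_nat_mul, Real.exp_le_exp, mul_div_assoc',
          div_le_div_iff₀ hK' (by norm_num)]
        nlinarith
      calc ((K : ℝ) ^ 2 / P * y) ^ q = ((K : ℝ) ^ 2 / P) ^ q * y ^ q := mul_pow _ _ _
        _ ≤ (2 * (4 * q) ^ q * psq q K P) * Real.exp (l / 4) := by
          gcongr; exact pow_le_psq hq hqK hKP hx
        _ ≤ (2 * (4 * q) ^ q * (2 * (l ^ 2 / n))) * Real.exp (l / 4) := by gcongr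
        _ = 4 * (4 * q) ^ q * (l ^ 2 / n) * Real.exp (l / 4) := by ring
        _ ≤ 1 := hsmall₂
    have hterm : ∀ b : Finset (Fin P), b.card = K →
        Real.exp (M * (n * p ^ 2 * commonProb q K P a b)) ≤ Real.exp 1 * y ^ (a ∩ b).card := by
      intro b hb
      rw [hy, ← Real.exp_nat_mul, ← Real.exp_add, Real.exp_le_exp]
      have h1 := commonProb_le hq hqK hKP hx ha hb
      have hLL : (n * (p * psq q K P)) ^ 2 ≤ (2 * l) ^ 2 := by gcongr
      have h2 : n * p ^ 2 * commonProb q K P a b ≤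
          2 * q / K * (a ∩ b).card * (2 * l) + 4 ^ (q + 2) * (l ^ 2 / n) := by
        calc n * p ^ 2 * commonProb q K P a b
            ≤ n * p ^ 2 * (2 * q / K * (a ∩ b).card * psq q K P +
                4 ^ (q + 1) * psq q K P ^ 2) := by gcongr
          _ = 2 * q / K * (a ∩ b).card * (p * (n * (p * psq q K P))) +
                4 ^ (q + 1) * ((n * (p * psq q K P)) ^ 2 / n) := by field_simp
          _ ≤ 2 * q / K * (a ∩ b).card * (1 * (2 * l)) + 4 ^ (q + 1) * ((2 * l) ^ 2 / n) := by
              gcongr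
          _ = _ := by ring
      calc M * (n * p ^ 2 * commonProb q K P a b)
          ≤ M * (2 * q / K * (a ∩ b).card * (2 * l) + 4 ^ (q + 2) * (l ^ 2 / n)) := by gcongr
        _ = 4 ^ (q + 2) * M * (l ^ 2 / n) + (a ∩ b).card * (4 * q * M * l / K) := by ring
        _ ≤ 1 + (a ∩ b).card * (4 * q * M * l / K) := by gcongr
    refine (sum_ringMass_mul_le hterm).trans ?_
    simp only [mul_left_comm (ringMass K P _) (Real.exp 1)]
    rw [← Finset.mul_sum]
    calc Real.exp 1 * ∑ b, ringMass K P b * y ^ (a ∩ b).card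
        ≤ Real.exp 1 * Real.exp ((K : ℝ) ^ 2 / P * (y - 1)) := by
          gcongr; exact sum_ringMass_mul_pow_le (by omega) hKP ha hy1
      _ = Real.exp (1 + (K : ℝ) ^ 2 / P * (y - 1)) := (Real.exp_add _ _).symm
      _ ≤ Real.exp (2 * M + 2) := by
        rw [Real.exp_le_exp]
        have : 0 ≤ (K : ℝ) ^ 2 / P := by positivity
        linarith

lemma psq_le_one (q K P : ℕ) : psq q K P ≤ 1 :=
  sub_le_self _ (Finset.sum_nonneg fun _ _ => by positivity)

lemma tendsto_const_mul_log_sq_div_mul_exp (c : ℝ) :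
    Tendsto (fun n : ℕ => c * (Real.log n ^ 2 / n) * Real.exp (Real.log n / 4)) atTop (nhds 0) := by
  have hlog : Tendsto (fun n : ℕ => 3 / 4 * Real.log n) atTop atTop :=
    (Real.tendsto_log_atTop.comp tendsto_natCast_atTop_atTop).const_mul_atTop (by norm_num)
  have h := ((Real.tendsto_pow_mul_exp_neg_atTop_nhds_zero 2).comp hlog).const_mul (c * (16 / 9))
  rw [mul_zero] at h
  refine h.congr' ?_
  filter_upwards [eventually_gt_atTop 0] with n hn
  have hn' : (0 : ℝ) < n := by exact_mod_cast hn
  have e : Real.exp (Real.log n / 4) = Real.exp (-(3 / 4 * Real.log n)) * n := by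
    nth_rewrite 3 [← Real.exp_log hn']
    rw [← Real.exp_add]
    congr 1
    ring
  simp only [Function.comp_apply]
  rw [e]
  field_simp
  ring

lemma eventually_half_log_le_and_le_two_mul_log {L : ℕ → ℝ}
    (hL : ∃ C : ℝ, ∀ᶠ n : ℕ in atTop,
      |(L n - Real.log n) / Real.log (Real.log n)| ≤ C) :
    ∀ᶠ n : ℕ in atTop, Real.log n / 2 ≤ L n ∧ L n ≤ 2 * Real.log n := by
  obtain ⟨C, hC⟩ := hL
  have hlog : Tendsto (fun n : ℕ => Real.log n) atTop atTop :=
    Real.tendsto_log_atTop.comp tendsto_natCast_atTop_atTop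
  have hpos : (0 : ℝ) < 1 / (2 * (|C| + 1)) := by positivity
  have hlo := hlog.eventually (Real.isLittleO_log_id_atTop.bound hpos)
  filter_upwards [hC, hlo, hlog.eventually_gt_atTop 1] with n h1 h2 h3
  have hll : 0 < Real.log (Real.log n) := Real.log_pos h3
  rw [abs_div, abs_of_pos hll, div_le_iff₀ hll] at h1
  rw [id_eq, Real.norm_of_nonneg hll.le, Real.norm_of_nonneg (by linarith), one_div,
    inv_mul_eq_div, le_div_iff₀ (by positivity)] at h2
  have h4 : C * Real.log (Real.log n) ≤ |C| * Real.log (Real.log n) := by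
    gcongr; exact le_abs_self C
  have h5 := abs_le.1 h1
  constructor <;> nlinarith

end Asymptotics

/-- if `K_n → ∞`, `K_n²/P_n → 0` and `(n p_{e,q}(n) − ln n)/ln ln n`
is bounded, then, for fixed `m ≥ 1` and `h ≥ 0`, the probability that the first
`m` vertices all have degree exactly `h` AND (some two of them are adjacent, or
some other vertex is adjacent to at least two of them) is
`o((h!)^{−m} (n p_{e,q}(n))^{hm} e^{−m n p_{e,q}(n)})`. -/
theorem prob_degree_h_with_dependency_is_little_o
    (q : ℕ) (hq : 1 ≤ q) (m : ℕ) (hm : 1 ≤ m) (h : ℕ)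
    (K P : ℕ → ℕ) (p : ℕ → ℝ)
    (hK1 : ∀ n, 1 ≤ K n) (hKP : ∀ n, K n ≤ P n)
    (hp : ∀ n, p n ∈ Set.Ioc (0 : ℝ) 1)
    (hKinf : Tendsto (fun n => (K n : ℝ)) atTop atTop)
    (hKsqP : Tendsto (fun n => ((K n : ℝ)) ^ 2 / (P n : ℝ)) atTop (nhds 0))
    (hbounded : ∃ C : ℝ, ∀ᶠ (n : ℕ) in atTop,
      |((n : ℝ) * peq q (K n) (P n) (p n) - Real.log (n : ℝ)) / Real.log (Real.log (n : ℝ))| ≤ C) :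
    Tendsto (fun n =>
        prob n (K n) (P n) (p n)
            {ω | (∀ i : Fin n, (i : ℕ) < m → degree q n (P n) ω i = h) ∧
              ((∃ i j : Fin n, (i : ℕ) < m ∧ (j : ℕ) < m ∧ Adj q n (P n) ω i j) ∨
                (∃ w i j : Fin n, m ≤ (w : ℕ) ∧ (i : ℕ) < m ∧ (j : ℕ) < m ∧ i ≠ j ∧
                  Adj q n (P n) ω w i ∧ Adj q n (P n) ω w j))} /
          (((Nat.factorial h : ℝ) ^ m)⁻¹ *
            ((n : ℝ) * peq q (K n) (P n) (p n)) ^ (h * m) *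
            Real.exp (-((m : ℝ) * ((n : ℝ) * peq q (K n) (P n) (p n))))))
      atTop (nhds 0) := by
  classical
  set L : ℕ → ℝ := fun n => (n : ℝ) * peq q (K n) (P n) (p n) with hLdef
  set M : ℕ := m * m - m with hM
  set D : ℝ := (h.factorial : ℝ) ^ m * ((h * m : ℕ) * ((m : ℝ) ^ (h * m) *
    (Real.exp ((m + (h * m : ℕ)) * m) * (1 + M * Real.exp (2 * M + 2))))) with hD
  have hlog : Tendsto (fun n : ℕ => Real.log n) atTop atTop :=
    Real.tendsto_log_atTop.comp tendsto_natCast_atTop_atTop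
  have hlim : Tendsto (fun n : ℕ => D * (Real.log n / 2)⁻¹) atTop (nhds 0) := by
    simpa using (tendsto_inv_atTop_zero.comp (hlog.atTop_div_const two_pos)).const_mul D
  have hmain : ∀ᶠ n : ℕ in atTop, 0 < L n ∧
      prob n (K n) (P n) (p n)
            {ω | (∀ i : Fin n, (i : ℕ) < m → degree q n (P n) ω i = h) ∧
              ((∃ i j : Fin n, (i : ℕ) < m ∧ (j : ℕ) < m ∧ Adj q n (P n) ω i j) ∨
                (∃ w i j : Fin n, m ≤ (w : ℕ) ∧ (i : ℕ) < m ∧ (j : ℕ) < m ∧ i ≠ j ∧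
                  Adj q n (P n) ω w i ∧ Adj q n (P n) ω w j))} ≤
        D * (Real.log n / 2)⁻¹ * (((h.factorial : ℝ) ^ m)⁻¹ * L n ^ (h * m) *
          Real.exp (-(m * L n))) := by
    filter_upwards [eventually_half_log_le_and_le_two_mul_log hbounded,
      hlog.eventually_ge_atTop 2, eventually_ge_atTop (m + 1),
      hKinf.eventually_ge_atTop (2 * q : ℝ), hKinf.eventually_ge_atTop (16 * q ^ 2 * M : ℝ),
      hKsqP.eventually_le_const (by norm_num : (0 : ℝ) < 1 / 2),
      (tendsto_const_mul_log_sq_div_mul_exp (4 ^ (q + 2) * M)).eventually_le_const one_pos,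
      (tendsto_const_mul_log_sq_div_mul_exp (4 * (4 * q) ^ q)).eventually_le_const one_pos]
      with n hL hl hn hK2q hKM hx hsmall₁ hsmall₂
    have hqK : 2 * q ≤ K n := by exact_mod_cast hK2q
    obtain ⟨hp0, hp1⟩ := hp n
    have hL1 : 1 ≤ L n := le_trans (by linarith) hL.1
    set A : Finset (Fin n) := univ.filter fun i => (i : ℕ) < m with hA
    have hAm : A.card = m := by
      rw [hA, Fin.card_filter_val_lt]; omega
    have hAM : A.offDiag.card = M := by rw [offDiag_card, hAm]
    have hs₁ : 4 ^ (q + 2) * M * (Real.log n ^ 2 / n) ≤ 1 :=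
      le_trans (le_mul_of_one_le_right (by positivity) (Real.one_le_exp (by linarith))) hsmall₁
    have hb := prob_dependency_le (h := h) hp0.le hp1 (hKP n) (by omega : q ≤ K n) A
      (Real.exp_pos (2 * M + 2)).le (fun a ha => by
        rw [hAM]
        exact sum_ringMass_exp_commonProb_le hq hqK (hKP n) hx hp0 hp1 (by omega) (by linarith)
          hL.2 hKM hs₁ hsmall₂ ha)
    rw [hAm, hAM] at hb
    refine ⟨by linarith, ?_⟩
    have hset : {ω : Config n (P n) | (∀ i : Fin n, (i : ℕ) < m → degree q n (P n) ω i = h) ∧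
              ((∃ i j : Fin n, (i : ℕ) < m ∧ (j : ℕ) < m ∧ Adj q n (P n) ω i j) ∨
                (∃ w i j : Fin n, m ≤ (w : ℕ) ∧ (i : ℕ) < m ∧ (j : ℕ) < m ∧ i ≠ j ∧
                  Adj q n (P n) ω w i ∧ Adj q n (P n) ω w j))} =
        {ω | (∀ i ∈ A, degree q n (P n) ω i = h) ∧
          ((∃ i ∈ A, ∃ j ∈ A, Adj q n (P n) ω i j) ∨
            ∃ w ∉ A, ∃ i ∈ A, ∃ j ∈ A, i ≠ j ∧ Adj q n (P n) ω w i ∧ Adj q n (P n) ω w j)} := by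
      ext ω
      simp only [hA, mem_filter, mem_univ, true_and, not_lt, Set.mem_ofPred_eq, exists_and_left]
    rw [hset]
    refine hb.trans ?_
    have hpe1 : peq q (K n) (P n) (p n) ≤ 1 :=
      mul_le_one₀ hp1 (psq_nonneg (hKP n) (by omega)) (psq_le_one _ _ _)
    have hpe0 : 0 ≤ peq q (K n) (P n) (p n) :=
      mul_nonneg hp0.le (psq_nonneg (hKP n) (by omega))
    have hm' : (1 : ℝ) ≤ m := by exact_mod_cast hm
    have hterm : ∀ t ∈ range (h * m), ((m : ℝ) * (n * peq q (K n) (P n) (p n))) ^ t *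
        (Real.exp (-(m * (n * peq q (K n) (P n) (p n)))) *
          Real.exp ((m + t) * (m * peq q (K n) (P n) (p n))) * (1 + M * Real.exp (2 * M + 2))) ≤
        (m : ℝ) ^ (h * m) * (L n ^ (h * m) * (Real.log n / 2)⁻¹) * (Real.exp (-(m * L n)) *
          Real.exp ((m + (h * m : ℕ)) * m) * (1 + M * Real.exp (2 * M + 2))) := by
      intro t ht
      have ht' := mem_range.1 ht
      have e1 : L n ^ t ≤ L n ^ (h * m) * (Real.log n / 2)⁻¹ := by
        rw [← div_eq_mul_inv, le_div_iff₀ (by linarith)]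
        calc L n ^ t * (Real.log n / 2) ≤ L n ^ t * L n := by gcongr; exact hL.1
          _ = L n ^ (t + 1) := (pow_succ _ _).symm
          _ ≤ L n ^ (h * m) := pow_le_pow_right₀ hL1 ht'
      have e2 : (m : ℝ) ^ t ≤ (m : ℝ) ^ (h * m) := pow_le_pow_right₀ hm' ht'.le
      have e3 : ((m : ℝ) + t) * (m * peq q (K n) (P n) (p n)) ≤ (m + (h * m : ℕ)) * m := by
        have : (t : ℝ) ≤ (h * m : ℕ) := by exact_mod_cast ht'.le
        have : (m : ℝ) * peq q (K n) (P n) (p n) ≤ m := mul_le_of_le_one_right (by linarith) hpe1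
        have : 0 ≤ (m : ℝ) * peq q (K n) (P n) (p n) := mul_nonneg (by linarith) hpe0
        gcongr
      rw [mul_pow]
      change (m : ℝ) ^ t * L n ^ t * (Real.exp (-(m * L n)) * _ * _) ≤ _
      gcongr
    refine (Finset.sum_le_card_nsmul _ _ _ hterm).trans (le_of_eq ?_)
    rw [card_range, nsmul_eq_mul, hD]
    have hfac : ((h.factorial : ℝ) ^ m) ≠ 0 := by positivity
    field_simp
  refine squeeze_zero' ?_ ?_ hlim
  · filter_upwards [hmain] with n hn
    have := hn.1
    exact div_nonneg (prob_nonneg (hp n).1.le (hp n).2 _) (by positivity)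
  · filter_upwards [hmain] with n hn
    have := hn.1
    exact (div_le_iff₀ (by positivity)).2 hn.2
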